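/- If the number of voters n ≥ 4 is even, then for every preference relation ▷ the tie-breaking Condorcet domain D_C^▷ is connected: it is weakly connected, and for every alternative x and all profiles R, R' in D_C^▷ with U(≻_i, x) = U(≻'_i, x) for all voters i, there is an ad-path from R to R' inside D_C^▷ along which x is never swapped. -/

import Mathlib

open scoped Classical
open Finset

/-- A preference relation: a complete, transitive, and antisymmetric binary relation. -/
def IsPref {A : Type*} (r : A → A → Prop) : Prop :=
  (∀ x y : A, x ≠ y → r x y ∨ r y x) ∧
  (∀ x y z : A, r x y → r y z → r x z) ∧
  (∀ x y : A, r x y → ¬ r y x)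

/-- A preference profile for `n` voters over alternatives `A`. -/
abbrev Prof (n : ℕ) (A : Type*) := Fin n → A → A → Prop

/-- Every voter's relation is a preference relation. -/
def IsProf {n : ℕ} {A : Type*} (R : Prof n A) : Prop := ∀ i, IsPref (R i)

/-- The majority margin `g_R(x,y)`. -/
noncomputable def margin {n : ℕ} {A : Type*} (R : Prof n A) (x y : A) : ℤ :=
  (Nat.card {i : Fin n // R i x y} : ℤ) - (Nat.card {i : Fin n // R i y x} : ℤ)

/-- `x` is the Condorcet winner of `R`. -/
def CondorcetWinner {n : ℕ} {A : Type*} (R : Prof n A) (x : A) : Prop :=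
  ∀ y, y ≠ x → 0 < margin R x y

/-- The Condorcet domain: all profiles admitting a Condorcet winner. -/
def CondorcetDomain (n : ℕ) (A : Type*) : Set (Prof n A) :=
  {R | IsProf R ∧ ∃ x, CondorcetWinner R x}

/-- The `(n+1)`-voter profile `(R, ▷)` obtained from `R` by adding `t` as an extra voter. -/
def tieProf {n : ℕ} {A : Type*} (R : Prof n A) (t : A → A → Prop) : Prof (n + 1) A :=
  Fin.cons t R

/-- The tie-breaking Condorcet domain `D_C^▷`. -/
def TieCondorcetDomain (n : ℕ) {A : Type*} (t : A → A → Prop) : Set (Prof n A) :=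
  {R | IsProf R ∧ ∃ x, CondorcetWinner (tieProf R t) x}

/-- Upper contour set `U(≻, x)`. -/
def UC {A : Type*} (r : A → A → Prop) (x : A) : Set A := {y | r y x ∨ y = x}

/-- Probability that the lottery `p` assigns to the set `S`. -/
noncomputable def mass {A : Type*} [Fintype A] (p : A → ℝ) (S : Set A) : ℝ :=
  ∑ y, S.indicator p y

/-- Stochastic dominance `p ≿^SD q` w.r.t. the preference relation `r`. -/
def SDdom {A : Type*} [Fintype A] (r : A → A → Prop) (p q : A → ℝ) : Prop :=
  ∀ x, mass q (UC r x) ≤ mass p (UC r x)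

/-- `f` is a social decision scheme on the domain `D`: on `D` it returns lotteries. -/
def IsSDS {n : ℕ} {A : Type*} [Fintype A] (D : Set (Prof n A))
    (f : Prof n A → A → ℝ) : Prop :=
  ∀ R ∈ D, (∀ x, 0 ≤ f R x) ∧ (∑ x, f R x) = 1

/-- Strategyproofness of `f` on `D`. -/
def Strategyproof {n : ℕ} {A : Type*} [Fintype A] (D : Set (Prof n A))
    (f : Prof n A → A → ℝ) : Prop :=
  ∀ R ∈ D, ∀ R' ∈ D, ∀ i : Fin n,
    (∀ j, j ≠ i → R j = R' j) → SDdom (R i) (f R) (f R')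

/-- Group-strategyproofness of `f` on `D`. -/
def GroupStrategyproof {n : ℕ} {A : Type*} [Fintype A] (D : Set (Prof n A))
    (f : Prof n A → A → ℝ) : Prop :=
  ∀ R ∈ D, ∀ R' ∈ D, ∀ I : Finset (Fin n), I.Nonempty →
    (∀ j ∉ I, R j = R' j) → ∃ i ∈ I, SDdom (R i) (f R) (f R')

/-- Non-imposition of `f` on `D`. -/
def NonImposing {n : ℕ} {A : Type*} [Fintype A] (D : Set (Prof n A))
    (f : Prof n A → A → ℝ) : Prop :=
  ∀ x : A, ∃ R ∈ D, f R x = 1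

/-- Ex post efficiency of `f` on `D`. -/
def ExPostEfficient {n : ℕ} {A : Type*} [Fintype A] (D : Set (Prof n A))
    (f : Prof n A → A → ℝ) : Prop :=
  ∀ R ∈ D, ∀ x y : A, (∀ i, R i x y) → f R y = 0

/-- `x` is top-ranked by the preference relation `r`. -/
def TopRanked {A : Type*} (r : A → A → Prop) (x : A) : Prop := ∀ y, y ≠ x → r x y

/-- The dictatorship of voter `i`. -/
noncomputable def dict {n : ℕ} {A : Type*} [Fintype A] (i : Fin n) (R : Prof n A) : A → ℝ :=
  fun x => if TopRanked (R i) x then 1 else 0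

/-- The Condorcet rule `COND`. -/
noncomputable def CondRule {n : ℕ} {A : Type*} [Fintype A] : Prof n A → A → ℝ :=
  fun R x => if CondorcetWinner R x then 1 else 0

/-- The tie-breaking Condorcet rule `COND^▷`. -/
noncomputable def TieCondRule {n : ℕ} {A : Type*} [Fintype A] (t : A → A → Prop) :
    Prof n A → A → ℝ :=
  fun R x => if CondorcetWinner (tieProf R t) x then 1 else 0

/-- The relation obtained from `r` by swapping the (adjacent) alternatives `x ≻ y`. -/
def swapRel {A : Type*} (r : A → A → Prop) (x y : A) : A → A → Prop :=
  fun a b => (a = y ∧ b = x) ∨ (r a b ∧ ¬(a = x ∧ b = y))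

/-- `R'` arises from `R` by letting voter `i` swap the adjacent alternatives `x ≻_i y`,
i.e., `R' = R^{i:yx}`. -/
def AdjSwap {n : ℕ} {A : Type*} (R R' : Prof n A) (i : Fin n) (x y : A) : Prop :=
  x ≠ y ∧ R i x y ∧ (∀ z, z ≠ x → z ≠ y → ¬(R i x z ∧ R i z y)) ∧
  R' i = swapRel (R i) x y ∧ (∀ j, j ≠ i → R' j = R j)

/-- A single ad-path step inside `D`. -/
def Step {n : ℕ} {A : Type*} (D : Set (Prof n A)) (R R' : Prof n A) : Prop :=
  R ∈ D ∧ R' ∈ D ∧ ∃ i x y, AdjSwap R R' i x y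

/-- A single ad-path step inside `D` in which the alternative `a` is not swapped. -/
def StepAvoiding {n : ℕ} {A : Type*} (D : Set (Prof n A)) (a : A) (R R' : Prof n A) : Prop :=
  R ∈ D ∧ R' ∈ D ∧ ∃ i x y, AdjSwap R R' i x y ∧ x ≠ a ∧ y ≠ a

/-- There is an ad-path from `R` to `R'` inside `D`. -/
def AdPath {n : ℕ} {A : Type*} (D : Set (Prof n A)) (R R' : Prof n A) : Prop :=
  R ∈ D ∧ R' ∈ D ∧ Relation.ReflTransGen (Step D) R R'

/-- There is an ad-path from `R` to `R'` inside `D` along which `a` is never swapped. -/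
def AdPathAvoiding {n : ℕ} {A : Type*} (D : Set (Prof n A)) (a : A) (R R' : Prof n A) : Prop :=
  R ∈ D ∧ R' ∈ D ∧ Relation.ReflTransGen (StepAvoiding D a) R R'

/-- `D` is weakly connected. -/
def WeaklyConnected {n : ℕ} {A : Type*} (D : Set (Prof n A)) : Prop :=
  ∀ R ∈ D, ∀ R' ∈ D, AdPath D R R'

/-- `D` is connected. -/
def Connected {n : ℕ} {A : Type*} (D : Set (Prof n A)) : Prop :=
  WeaklyConnected D ∧
  ∀ a : A, ∀ R ∈ D, ∀ R' ∈ D, (∀ i, UC (R i) a = UC (R' i) a) → AdPathAvoiding D a R R'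

/-- `T` is a profile that agrees with `R` and `R'` wherever these two agree. -/
def IsBetween {n : ℕ} {A : Type*} (R R' T : Prof n A) : Prop :=
  IsProf T ∧ ∀ i u v, R i u v → R' i u v → T i u v

/-- The profile `R` ranks alternatives of smaller level above those of larger level. -/
def RespectsLevel {n : ℕ} {A : Type*} (K : Fin n → A → ℕ) (R : Prof n A) : Prop :=
  ∀ i u v, K i u < K i v → R i u v

/-- A single ad-path step inside `D` that swaps two alternatives of the same level. -/
def LevelStep {n : ℕ} {A : Type*} (D : Set (Prof n A)) (K : Fin n → A → ℕ)
    (R R' : Prof n A) : Prop :=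
  R ∈ D ∧ R' ∈ D ∧ ∃ i x y, AdjSwap R R' i x y ∧ K i x = K i y

/-- The profile in which each voter sorts by level first and by `p` within each level. -/
def levelProf {n : ℕ} {A : Type*} (K : Fin n → A → ℕ) (p : A → ℕ) : Prof n A :=
  fun i u v => K i u < K i v ∨ (K i u = K i v ∧ p u < p v)

/-- A ranking function with `x` first, `y` second, and the others in a fixed order. -/
noncomputable def rankWith {A : Type*} [Fintype A] (x y u : A) : ℕ :=
  if u = x then 0 else if u = y then 1 else (Fintype.equivFin A u : ℕ) + 2

theorem rankWith_injective {A : Type*} [Fintype A] (x y : A) :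
    Function.Injective (rankWith x y) := by
  intro u v h
  unfold rankWith at h
  split_ifs at h with h1 h2 h3 h4 h5 h6 h7 h8
  all_goals first
    | (subst_vars; rfl)
    | (exfalso; omega)
    | exact (Fintype.equivFin A).injective (Fin.ext (by omega))

theorem IsPref.irrefl {A : Type*} {r : A → A → Prop} (h : IsPref r) (x : A) : ¬ r x x :=
  fun hx => h.2.2 x x hx hx

theorem isProf_levelProf {n : ℕ} {A : Type*} (K : Fin n → A → ℕ) {p : A → ℕ}
    (hp : Function.Injective p) : IsProf (levelProf K p) := by
  refine fun i => ⟨fun x y hxy => ?_, fun x y z => ?_, fun x y => ?_⟩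
  · have := hp.ne hxy
    unfold levelProf
    omega
  · unfold levelProf
    omega
  · unfold levelProf
    omega

theorem respectsLevel_levelProf {n : ℕ} {A : Type*} (K : Fin n → A → ℕ) (p : A → ℕ) :
    RespectsLevel K (levelProf K p) := fun _ _ _ h => Or.inl h

theorem RespectsLevel.le {n : ℕ} {A : Type*} {K : Fin n → A → ℕ} {R : Prof n A}
    (hK : RespectsLevel K R) (hR : IsProf R) {i : Fin n} {u v : A} (h : R i u v) :
    K i u ≤ K i v :=
  not_lt.1 fun hlt => (hR i).2.2 u v h (hK i v u hlt)

theorem isPref_swapRel {A : Type*} {r : A → A → Prop} (h : IsPref r) {x y : A}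
    (hxy : r x y) (hadj : ∀ z, z ≠ x → z ≠ y → ¬ (r x z ∧ r z y)) :
    IsPref (swapRel r x y) := by
  obtain ⟨htot, htrans, hasymm⟩ := h
  have hne : x ≠ y := by
    rintro rfl
    exact hasymm x x hxy hxy
  refine ⟨fun u v huv => ?_, fun u v w => ?_, fun u v => ?_⟩
  · have := htot u v huv
    unfold swapRel
    tauto
  · have h1 : ∀ z, r x z → z = y ∨ r y z := fun z hz => by
      by_contra! hc
      have hzx : z ≠ x := by
        rintro rfl
        exact hasymm z z hz hz
      exact hadj z hzx hc.1 ⟨hz, (htot z y hc.1).resolve_right hc.2⟩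
    have h2 : ∀ z, r z y → z = x ∨ r z x := fun z hz => by
      by_contra! hc
      have hzy : z ≠ y := by
        rintro rfl
        exact hasymm z z hz hz
      exact hadj z hc.1 hzy ⟨(htot z x hc.1).resolve_left hc.2, hz⟩
    unfold swapRel
    grind
  · unfold swapRel
    grind

/-- Two distinct orders disagree on a pair that is adjacent in the first one. -/
theorem exists_adjacent_disagreement {A : Type*} [Fintype A] {r r' : A → A → Prop}
    (hr : IsPref r) (hr' : IsPref r') {u v : A} (huv : r u v) (hvu : r' v u) :
    ∃ x y, r x y ∧ r' y x ∧ ∀ z, z ≠ x → z ≠ y → ¬ (r x z ∧ r z y) := by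
  induction hm : #{z | r u z ∧ r z v} using Nat.strong_induction_on generalizing u v with
  | _ m ih =>
    by_cases hz : ∃ z, r u z ∧ r z v
    · obtain ⟨z, huz, hzv⟩ := hz
      by_cases hzu : r' z u
      · refine ih _ ?_ huz hzu rfl
        rw [← hm]
        refine card_lt_card (Finset.ssubset_iff_of_subset ?_ |>.2 ⟨z, ?_, ?_⟩)
        · intro w
          simp only [mem_filter, mem_univ, true_and]
          exact fun h => ⟨h.1, hr.2.1 _ _ _ h.2 hzv⟩
        · simp [huz, hzv]
        · simp [hr.irrefl]
      · have huz' : r' u z := by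
          refine (hr'.1 u z ?_).resolve_right hzu
          rintro rfl
          exact hr.irrefl u huz
        refine ih _ ?_ hzv (hr'.2.1 _ _ _ hvu huz') rfl
        rw [← hm]
        refine card_lt_card (Finset.ssubset_iff_of_subset ?_ |>.2 ⟨z, ?_, ?_⟩)
        · intro w
          simp only [mem_filter, mem_univ, true_and]
          exact fun h => ⟨hr.2.1 _ _ _ huz h.1, h.2⟩
        · simp [huz, hzv]
        · simp [hr.irrefl]
    · exact ⟨u, v, huv, hvu, fun z _ _ h => hz ⟨z, h⟩⟩

/-- If every profile between `R` and `R'` lies in `D`, then `R'` is reachable from `R` in `D`. -/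
theorem levelStep_path_of_between {n : ℕ} {A : Type*} [Fintype A] {D : Set (Prof n A)}
    {K : Fin n → A → ℕ} {R R' : Prof n A} (hR : IsProf R) (hR' : IsProf R')
    (hK : RespectsLevel K R) (hK' : RespectsLevel K R')
    (hD : ∀ T, IsBetween R R' T → T ∈ D) :
    Relation.ReflTransGen (LevelStep D K) R R' := by
  induction hm : #{q : Fin n × A × A | R q.1 q.2.1 q.2.2 ∧ R' q.1 q.2.2 q.2.1}
    using Nat.strong_induction_on generalizing R with
  | _ m ih =>
    by_cases hdis : ∃ i u v, R i u v ∧ R' i v u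
    · obtain ⟨i, u, v, huv, hvu⟩ := hdis
      obtain ⟨x, y, hxy, hyx, hadj⟩ := exists_adjacent_disagreement (hR i) (hR' i) huv hvu
      have hne : x ≠ y := by
        rintro rfl
        exact (hR i).irrefl x hxy
      have hKxy : K i x = K i y := le_antisymm (hK.le hR hxy) (hK'.le hR' hyx)
      set T : Prof n A := Function.update R i (swapRel (R i) x y) with hT
      have hTi : T i = swapRel (R i) x y := by simp [hT]
      have hTj : ∀ j, j ≠ i → T j = R j := fun j hj => by simp [hT, hj]
      have hTprof : IsProf T := fun j => by
        by_cases hj : j = i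
        · subst hj
          rw [hTi]
          exact isPref_swapRel (hR j) hxy hadj
        · rw [hTj j hj]
          exact hR j
      have hsub : ∀ j a b, R j a b → R' j a b → T j a b := fun j a b h h' => by
        by_cases hj : j = i
        · subst hj
          rw [hTi]
          refine Or.inr ⟨h, ?_⟩
          rintro ⟨rfl, rfl⟩
          exact (hR' j).2.2 _ _ h' hyx
        · rw [hTj j hj]
          exact h
      have hback : ∀ j a b, T j a b → R' j b a → R j a b ∧ ¬ (j = i ∧ a = x ∧ b = y) :=
        fun j a b h h' => by
          by_cases hj : j = i
          · subst hj
            rw [hTi] at h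
            rcases h with ⟨rfl, rfl⟩ | ⟨h, h2⟩
            · exact absurd hyx ((hR' j).2.2 _ _ h')
            · exact ⟨h, fun h3 => h2 h3.2⟩
          · rw [hTj j hj] at h
            exact ⟨h, fun h3 => hj h3.1⟩
      have hTK : RespectsLevel K T := fun j a b h => hsub j a b (hK j a b h) (hK' j a b h)
      refine Relation.ReflTransGen.head
        ⟨hD R ⟨hR, fun _ _ _ h _ => h⟩, hD T ⟨hTprof, hsub⟩, i, x, y,
          ⟨hne, hxy, hadj, hTi, hTj⟩, hKxy⟩
        (ih _ ?_ hTprof hTK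
          (fun S hS => hD S ⟨hS.1, fun j a b h h' => hS.2 j a b (hsub j a b h h') h'⟩) rfl)
      rw [← hm]
      refine card_lt_card (Finset.ssubset_iff_of_subset ?_ |>.2 ⟨(i, x, y), ?_, ?_⟩)
      · rintro ⟨j, a, b⟩
        simp only [mem_filter, mem_univ, true_and]
        exact fun h => ⟨(hback j a b h.1 h.2).1, h.2⟩
      · simp [hxy, hyx]
      · simp only [mem_filter, mem_univ, true_and]
        exact fun h => (hback i x y h.1 h.2).2 ⟨rfl, rfl, rfl⟩
    · have hRR' : R = R' := by
        funext i u v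
        refine propext ⟨fun h => ?_, fun h => ?_⟩
        · have huv : u ≠ v := by
            rintro rfl
            exact (hR i).irrefl u h
          exact ((hR' i).1 u v huv).resolve_right fun h' => hdis ⟨i, u, v, h, h'⟩
        · have huv : u ≠ v := by
            rintro rfl
            exact (hR' i).irrefl u h
          exact ((hR i).1 u v huv).resolve_right fun h' => hdis ⟨i, v, u, h', h⟩
      rw [hRR']

theorem isProf_tieProf {n : ℕ} {A : Type*} {R : Prof n A} {t : A → A → Prop}
    (hR : IsProf R) (ht : IsPref t) : IsProf (tieProf R t) :=
  Fin.cases ht hR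

theorem margin_mono {n : ℕ} {A : Type*} {R R' : Prof n A} (hR : IsProf R) (hR' : IsProf R')
    {x y : A} (hxy : x ≠ y) (h : ∀ i, R i x y → R' i x y) : margin R x y ≤ margin R' x y := by
  have h1 : Nat.card {i // R i x y} ≤ Nat.card {i // R' i x y} :=
    Nat.card_le_card_of_injective _ (Subtype.map_injective h Function.injective_id)
  have h' : ∀ i, R' i y x → R i y x := fun i hi =>
    ((hR i).1 x y hxy).resolve_left fun hi' => (hR' i).2.2 _ _ (h i hi') hi
  have h2 : Nat.card {i // R' i y x} ≤ Nat.card {i // R i y x} :=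
    Nat.card_le_card_of_injective _ (Subtype.map_injective h' Function.injective_id)
  unfold margin
  omega

theorem margin_tieProf_mono {n : ℕ} {A : Type*} {R R' : Prof n A} {t : A → A → Prop}
    (ht : IsPref t) (hR : IsProf R) (hR' : IsProf R') {x y : A} (hxy : x ≠ y)
    (h : ∀ i, R i x y → R' i x y) : margin (tieProf R t) x y ≤ margin (tieProf R' t) x y :=
  margin_mono (isProf_tieProf hR ht) (isProf_tieProf hR' ht) hxy (Fin.cases id h)

theorem margin_pos_or_margin_pos {n : ℕ} {A : Type*} {R : Prof n A} (hn : Odd n)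
    (hR : IsProf R) {x y : A} (hxy : x ≠ y) : 0 < margin R x y ∨ 0 < margin R y x := by
  have hcard : Nat.card {i // R i x y} + Nat.card {i // R i y x} = n := by
    have hiff : ∀ i, R i y x ↔ ¬ R i x y := fun i =>
      ⟨(hR i).2.2 y x, ((hR i).1 x y hxy).resolve_left⟩
    simp only [hiff, Nat.card_eq_fintype_card]
    rw [Fintype.card_subtype_compl, Fintype.card_fin]
    have := Fintype.card_subtype_le fun i => R i x y
    rw [Fintype.card_fin] at this
    omega
  obtain ⟨k, hk⟩ := hn
  unfold margin
  omega

/-- Raising the Condorcet winner `x` leaves it the Condorcet winner. -/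
theorem CondorcetWinner.of_improved {n : ℕ} {A : Type*} {R R' : Prof n A}
    {t : A → A → Prop} (ht : IsPref t) (hR : IsProf R) (hR' : IsProf R') {x : A}
    (hx : CondorcetWinner (tieProf R t) x) (h : ∀ i y, R i x y → R' i x y) :
    CondorcetWinner (tieProf R' t) x := fun y hy =>
  (hx y hy).trans_le (margin_tieProf_mono ht hR hR' hy.symm fun i => h i y)

theorem levelProf_rankWith_of_rel {n : ℕ} {A : Type*} [Fintype A] {K : Fin n → A → ℕ}
    {R : Prof n A} (hR : IsProf R) (hK : RespectsLevel K R) (x x' : A) (i : Fin n) (y : A)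
    (h : R i x y) : levelProf K (rankWith x x') i x y := by
  have hne : y ≠ x := by
    rintro rfl
    exact (hR i).irrefl y h
  refine (hK.le hR h).lt_or_eq.imp_right fun h' => ⟨h', ?_⟩
  simp only [rankWith, hne, if_true, if_false]
  split_ifs <;> omega

theorem levelProf_rankWith_swap {n : ℕ} {A : Type*} [Fintype A] {K : Fin n → A → ℕ}
    {x x' y : A} (hx : y ≠ x) (hx' : y ≠ x') {i : Fin n}
    (h : levelProf K (rankWith x x') i x y) : levelProf K (rankWith x' x) i x y := by
  refine h.imp_right fun h' => ⟨h'.1, ?_⟩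
  simp only [rankWith, hx, hx', if_true, if_false]
  split_ifs <;> omega

theorem levelStep_path {n : ℕ} {A : Type*} [Fintype A] (heven : Even n)
    {t : A → A → Prop} (ht : IsPref t) {K : Fin n → A → ℕ} {R R' : Prof n A}
    (hR : R ∈ TieCondorcetDomain n t) (hR' : R' ∈ TieCondorcetDomain n t)
    (hK : RespectsLevel K R) (hK' : RespectsLevel K R') :
    Relation.ReflTransGen (LevelStep (TieCondorcetDomain n t) K) R R' := by
  obtain ⟨hR, x, hx⟩ := hR
  obtain ⟨hR', x', hx'⟩ := hR'
  have hS := isProf_levelProf K (rankWith_injective x x')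
  have hS' := isProf_levelProf K (rankWith_injective x' x)
  have hSK := respectsLevel_levelProf K (rankWith x x')
  have hSK' := respectsLevel_levelProf K (rankWith x' x)
  have hxS := levelProf_rankWith_of_rel hR hK x x'
  have hxS' := levelProf_rankWith_of_rel hR' hK' x' x
  refine ((levelStep_path_of_between hR hS hK hSK fun T hT => ?_).trans
    (levelStep_path_of_between hS hS' hSK hSK' fun T hT => ?_)).trans
    (levelStep_path_of_between hS' hR' hSK' hK' fun T hT => ?_)
  · exact ⟨hT.1, x, hx.of_improved ht hR hT.1 fun i y h => hT.2 i x y h (hxS i y h)⟩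
  · have hbeats : ∀ y, y ≠ x → y ≠ x' → 0 < margin (tieProf T t) x y := fun y hy hy' =>
      (hx y hy).trans_le <| margin_tieProf_mono ht hR hT.1 hy.symm fun i h =>
        hT.2 i x y (hxS i y h) (levelProf_rankWith_swap hy hy' (hxS i y h))
    have hbeats' : ∀ y, y ≠ x → y ≠ x' → 0 < margin (tieProf T t) x' y := fun y hy hy' =>
      (hx' y hy').trans_le <| margin_tieProf_mono ht hR' hT.1 hy'.symm fun i h =>
        hT.2 i x' y (levelProf_rankWith_swap hy' hy (hxS' i y h)) (hxS' i y h)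
    refine ⟨hT.1, ?_⟩
    by_cases hxx : x = x'
    · subst hxx
      exact ⟨x, fun y hy => hbeats y hy hy⟩
    · rcases margin_pos_or_margin_pos heven.add_one (isProf_tieProf hT.1 ht) hxx with h | h
      · refine ⟨x, fun y hy => ?_⟩
        by_cases hy' : y = x'
        · exact hy' ▸ h
        · exact hbeats y hy hy'
      · refine ⟨x', fun y hy' => ?_⟩
        by_cases hy : y = x
        · exact hy ▸ h
        · exact hbeats' y hy hy'
  · exact ⟨hT.1, x', hx'.of_improved ht hR' hT.1 fun i y h => hT.2 i x' y (hxS' i y h) h⟩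

/-- The level of an alternative relative to `a`: above `a`, equal to `a`, or below `a`. -/
noncomputable def levelAt {A : Type*} (r : A → A → Prop) (a u : A) : ℕ :=
  if r u a then 0 else if u = a then 1 else 2

theorem levelAt_eq_levelAt_self {A : Type*} {r : A → A → Prop} (hr : IsPref r) {a u : A}
    (h : levelAt r a u = levelAt r a a) : u = a := by
  by_contra hne
  unfold levelAt at h
  have := hr.irrefl a
  split_ifs at h <;> simp_all

theorem rel_of_levelAt_lt {A : Type*} {r : A → A → Prop} (hr : IsPref r) {a u v : A}
    (h : levelAt r a u < levelAt r a v) : r u v := by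
  obtain ⟨htot, htrans, hasymm⟩ := hr
  unfold levelAt at h
  grind

theorem levelAt_congr {A : Type*} {r r' : A → A → Prop} (hr : IsPref r) (hr' : IsPref r')
    {a : A} (h : UC r a = UC r' a) : levelAt r a = levelAt r' a := by
  funext u
  have hu : (r u a ∨ u = a) ↔ (r' u a ∨ u = a) := Set.ext_iff.1 h u
  have h1 := hr.irrefl a
  have h2 := hr'.irrefl a
  unfold levelAt
  grind

/-- If `n ≥ 4` is even, every tie-breaking Condorcet domain is connected. -/
theorem tieCondorcetDomain_connected {n : ℕ} {A : Type*} [Fintype A]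
    (hn : 4 ≤ n) (heven : Even n) (hA : 3 ≤ Fintype.card A)
    (t : A → A → Prop) (ht : IsPref t) :
    Connected (TieCondorcetDomain n t) := by
  refine ⟨fun R hR R' hR' => ⟨hR, hR', ?_⟩, fun a R hR R' hR' hUC => ⟨hR, hR', ?_⟩⟩
  · refine Relation.ReflTransGen.mono ?_ _ _
      (levelStep_path (K := fun _ _ => 0) heven ht hR hR' ?_ ?_)
    · rintro S T ⟨hS, hT, i, x, y, h, -⟩
      exact ⟨hS, hT, i, x, y, h⟩
    · exact fun _ _ _ h => absurd h (lt_irrefl 0)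
    · exact fun _ _ _ h => absurd h (lt_irrefl 0)
  · refine Relation.ReflTransGen.mono ?_ _ _
      (levelStep_path (K := fun i => levelAt (R i) a) heven ht hR hR'
        (fun i _ _ h => rel_of_levelAt_lt (hR.1 i) h) (fun i u v h => ?_))
    · rintro S T ⟨hS, hT, i, x, y, h, hxy⟩
      refine ⟨hS, hT, i, x, y, h, ?_, ?_⟩
      · rintro rfl
        exact h.1 (levelAt_eq_levelAt_self (hR.1 i) hxy.symm).symm
      · rintro rfl
        exact h.1 (levelAt_eq_levelAt_self (hR.1 i) hxy)
    · simp only [levelAt_congr (hR.1 i) (hR'.1 i) (hUC i)] at h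
      exact rel_of_levelAt_lt (hR'.1 i) h
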